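/- Let n, k, s be non-negative integers and let α be a real number with 1 < α ≤ 2 − 1/k, such that n ≥ αk(s+1) + k − 1. If F is a family of k-element subsets of [n] = {1,…,n} whose maximum matching has size exactly s, then |F| ≤ C(n,k) − C(n−s,k) + ((2−α)k − 1)/(αk − 1) · s · C(n−s−1, k−1), where C(a,b) denotes the binomial coefficient. -/

import Mathlib

/-- every matching in `F` has at most `s` members -/
def NoMatch (F : Finset (Finset ℕ)) (s : ℕ) : Prop :=
  ∀ M ⊆ F, (M : Set (Finset ℕ)).PairwiseDisjoint id → M.card ≤ s

/-- `F` is left-shifted on the elements `≥ a` -/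
def Shifted (F : Finset (Finset ℕ)) (a : ℕ) : Prop :=
  ∀ A ∈ F, ∀ j ∈ A, ∀ i, a ≤ i → i < j → i ∉ A → insert i (A.erase j) ∈ F

lemma noMatch_map {F M : Finset (Finset ℕ)} {s : ℕ} (hF : NoMatch F s) (σ : Equiv.Perm ℕ)
    (hM : (M : Set (Finset ℕ)).PairwiseDisjoint id)
    (h : ∀ E ∈ M, E.map σ.toEmbedding ∈ F) : M.card ≤ s := by
  classical
  have h1 := hF (M.image (fun E => E.map σ.toEmbedding)) (by
    intro E hE
    obtain ⟨E', hE', rfl⟩ := Finset.mem_image.1 hE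
    exact h E' hE') (by
    intro E hE E' hE' hne
    obtain ⟨D, hD, rfl⟩ := Finset.mem_image.1 (Finset.mem_coe.1 hE)
    obtain ⟨D', hD', rfl⟩ := Finset.mem_image.1 (Finset.mem_coe.1 hE')
    have : D ≠ D' := fun h => hne (by rw [h])
    have := hM hD hD' this
    simp only [Function.onFun, id] at this ⊢
    exact (Finset.disjoint_map _).2 this)
  rwa [Finset.card_image_of_injective _ (Finset.map_injective _)] at h1

lemma map_swap_eq {E : Finset ℕ} {i j : ℕ} (hj : j ∈ E) (hi : i ∉ E) :
    E.map (Equiv.swap i j).toEmbedding = insert i (E.erase j) := by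
  ext x
  simp only [Finset.mem_map_equiv, Equiv.symm_swap, Equiv.swap_apply_def]
  grind

lemma map_swap_eq' {E : Finset ℕ} {i j : ℕ} (hj : j ∉ E) (hi : i ∉ E) :
    E.map (Equiv.swap i j).toEmbedding = E := by
  ext x
  simp only [Finset.mem_map_equiv, Equiv.symm_swap, Equiv.swap_apply_def]
  grind

lemma map_swap_back {B : Finset ℕ} {i j : ℕ} (hj : j ∈ B) (hi : i ∉ B) :
    (insert i (B.erase j)).map (Equiv.swap i j).toEmbedding = B := by
  ext x
  simp only [Finset.mem_map_equiv, Equiv.symm_swap, Equiv.swap_apply_def]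
  grind

/-- The shift of a single set relative to the family `F`. -/
def shiftSet (F : Finset (Finset ℕ)) (i j : ℕ) (B : Finset ℕ) : Finset ℕ :=
  if j ∈ B ∧ i ∉ B ∧ insert i (B.erase j) ∉ F then insert i (B.erase j) else B

lemma sum_shift {B : Finset ℕ} {i j : ℕ} (hj : j ∈ B) (hi : i ∉ B) (hij : i < j) :
    ∑ a ∈ insert i (B.erase j), a < ∑ a ∈ B, a := by
  rw [Finset.sum_insert (by grind), ← Finset.add_sum_erase B (fun a => a) hj]
  simpa using hij

lemma exists_shifted (k n s : ℕ) : ∀ (w : ℕ) (F : Finset (Finset ℕ)),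
    ∑ A ∈ F, ∑ a ∈ A, a = w →
    F ⊆ (Finset.range n).powersetCard k → NoMatch F s →
    ∃ G ⊆ (Finset.range n).powersetCard k, NoMatch G s ∧ G.card = F.card ∧ Shifted G 0 := by
  classical
  intro w
  induction w using Nat.strong_induction_on with
  | _ w ih =>
  intro F hw hF hM
  by_cases hS : Shifted F 0
  · exact ⟨F, hF, hM, rfl, hS⟩
  unfold Shifted at hS
  push Not at hS
  obtain ⟨A, hA, j, hj, i, -, hij, hi, hn⟩ := hS
  have hinj : Set.InjOn (shiftSet F i j) F := by
    intro B hB B' hB' h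
    unfold shiftSet at h
    rw [Finset.mem_coe] at hB hB'
    split_ifs at h with h1 h2 h2
    · rw [← map_swap_back h1.1 h1.2.1, h, map_swap_back h2.1 h2.2.1]
    · exact absurd (h ▸ hB') h1.2.2
    · exact absurd (h ▸ hB) h2.2.2
    · exact h
  have hlt : ∑ A ∈ F.image (shiftSet F i j), ∑ a ∈ A, a < w := by
    rw [Finset.sum_image hinj, ← hw]
    apply Finset.sum_lt_sum
    · intro B hB
      unfold shiftSet
      split_ifs with h1
      · exact (sum_shift h1.1 h1.2.1 hij).le
      · exact le_rfl
    · refine ⟨A, hA, ?_⟩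
      unfold shiftSet
      rw [if_pos ⟨hj, hi, hn⟩]
      exact sum_shift hj hi hij
  obtain ⟨G, hG, hG1, hG2, hG3⟩ := ih _ hlt (F.image (shiftSet F i j)) rfl (by
    intro B hB
    obtain ⟨B, hB', rfl⟩ := Finset.mem_image.1 hB
    clear hB
    have hB := hB'
    have h2 := Finset.mem_powersetCard.1 (hF hB)
    unfold shiftSet
    split_ifs with h1
    · rw [Finset.mem_powersetCard]
      constructor
      · intro x hx
        have hjn := h2.1 h1.1
        rcases Finset.mem_insert.1 hx with rfl | hx
        · simp only [Finset.mem_range] at *; omega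
        · exact h2.1 (Finset.mem_of_mem_erase hx)
      · rw [Finset.card_insert_of_notMem (by grind), Finset.card_erase_of_mem h1.1, ← h2.2]
        have := Finset.card_pos.2 ⟨_, h1.1⟩
        omega
    · exact hF hB) (by
    intro M hMs hMd
    by_cases hMF : M ⊆ F
    · exact hM M hMF hMd
    obtain ⟨D, hD, hDF⟩ := Finset.not_subset.1 hMF
    obtain ⟨B, hB, hBD⟩ := Finset.mem_image.1 (hMs hD)
    unfold shiftSet at hBD
    split_ifs at hBD with h1
    swap
    · exact absurd (hBD ▸ hB) hDF
    apply noMatch_map hM (Equiv.swap i j) hMd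
    intro E hE
    by_cases hED : E = D
    · rw [hED, ← hBD, map_swap_back h1.1 h1.2.1]; exact hB
    have hdis := hMd hE hD hED
    simp only [Function.onFun, id] at hdis
    have hiE : i ∉ E := fun h => Finset.disjoint_left.1 hdis h (by rw [← hBD]; simp)
    obtain ⟨E', hE', hEE⟩ := Finset.mem_image.1 (hMs hE)
    unfold shiftSet at hEE
    split_ifs at hEE with h3
    · exact absurd (by rw [← hEE]; simp) hiE
    subst hEE
    by_cases hjE : j ∈ E'
    · rw [map_swap_eq hjE hiE]
      by_contra h4
      exact h3 ⟨hjE, hiE, h4⟩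
    · rw [map_swap_eq' hjE hiE]; exact hE')
  exact ⟨G, hG, hG1, by rw [hG2, Finset.card_image_of_injOn hinj], hG3⟩

/-- the double-counting bound for the shadow -/
lemma shadow_local (F : Finset (Finset ℕ)) (T : Finset ℕ) (k : ℕ) (hk : 1 ≤ k)
    (hF : F ⊆ T.powersetCard k) : F.card * k ≤ F.shadow.card * (T.card - (k - 1)) := by
  classical
  apply Finset.card_mul_le_card_mul (fun A G => G ⊆ A)
  · intro A hA
    have h := Finset.mem_powersetCard.1 (hF hA)
    rw [← h.2, ← Finset.card_image_of_injOn (f := fun x => A.erase x) (s := A)]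
    · apply Finset.card_le_card
      intro G hG
      obtain ⟨x, hx, rfl⟩ := Finset.mem_image.1 hG
      rw [Finset.mem_bipartiteAbove]
      exact ⟨Finset.mem_shadow_iff.2 ⟨A, hA, x, hx, rfl⟩, Finset.erase_subset _ _⟩
    · exact Finset.erase_injOn A
  · intro G hG
    obtain ⟨A, hA, x, hx, rfl⟩ := Finset.mem_shadow_iff.1 hG
    have h := Finset.mem_powersetCard.1 (hF hA)
    set G := A.erase x
    have hGc : G.card = k - 1 := by rw [Finset.card_erase_of_mem hx, h.2]
    have hGT : G ⊆ T := (Finset.erase_subset _ _).trans h.1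
    rw [← hGc, ← Finset.card_sdiff_of_subset hGT]
    refine le_trans (Finset.card_le_card ?_) (Finset.card_image_le (f := fun y => insert y G))
    intro D hD
    rw [Finset.mem_bipartiteBelow] at hD
    have h' := Finset.mem_powersetCard.1 (hF hD.1)
    have : (D \ G).card = 1 := by
      rw [Finset.card_sdiff_of_subset hD.2, h'.2, hGc]; omega
    obtain ⟨y, hy⟩ := Finset.card_eq_one.1 this
    have hyD : y ∈ D \ G := by rw [hy]; simp
    rw [Finset.mem_sdiff] at hyD
    refine Finset.mem_image.2 ⟨y, Finset.mem_sdiff.2 ⟨h'.1 hyD.1, hyD.2⟩, ?_⟩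
    show insert y G = D
    rw [Finset.insert_eq, ← hy, Finset.sdiff_union_of_subset hD.2]

/-- Given disjoint sets and many spare elements, extend each by a distinct spare element. -/
lemma extend_matching (F M : Finset (Finset ℕ)) (R : Finset ℕ) (s : ℕ) (hF : NoMatch F s)
    (hM : (M : Set (Finset ℕ)).PairwiseDisjoint id)
    (hR : M.card ≤ R.card) (hd : ∀ G ∈ M, Disjoint G R)
    (h : ∀ G ∈ M, ∀ x ∈ R, insert x G ∈ F) : M.card ≤ s := by
  classical
  obtain ⟨f, hf, hfi⟩ : ∃ f : Finset ℕ → ℕ, (∀ G ∈ M, f G ∈ R) ∧ Set.InjOn f M := by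
    obtain ⟨R', hR', hc⟩ := Finset.exists_subset_card_eq hR
    obtain ⟨e⟩ : Nonempty (M ≃ R') := ⟨Finset.equivOfCardEq hc.symm⟩
    refine ⟨fun G => if hG : G ∈ M then (e ⟨G, hG⟩ : ℕ) else 0, ?_, ?_⟩
    · intro G hG
      simp only [hG, dif_pos]
      exact hR' (e ⟨G, hG⟩).2
    · intro G hG G' hG' hh
      rw [Finset.mem_coe] at hG hG'
      simp only [hG, hG', dif_pos] at hh
      have := e.injective (Subtype.ext hh)
      simpa using this
  have hdisj : ∀ G ∈ M, ∀ G' ∈ M, G ≠ G' → Disjoint (insert (f G) G) (insert (f G') G') := by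
    intro G hG G' hG' hne
    have h1 : Disjoint G G' := hM hG hG' hne
    have h2 := hd G hG
    have h3 := hd G' hG'
    have h4 := hf G hG
    have h5 := hf G' hG'
    have h6 : f G ≠ f G' := fun hh => hne (hfi hG hG' hh)
    rw [Finset.disjoint_insert_left, Finset.disjoint_insert_right, Finset.mem_insert]
    refine ⟨?_, Finset.disjoint_right.1 h2 h5, h1⟩
    rintro (h7 | h7)
    · exact h6 h7
    · exact Finset.disjoint_left.1 h3 h7 h4
  have hinj : Set.InjOn (fun G => insert (f G) G) M := by
    intro G hG G' hG' hh
    by_contra hne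
    have := hdisj G hG G' hG' hne
    simp only at hh
    rw [hh, disjoint_self] at this
    exact Finset.insert_ne_empty _ _ this
  rw [← Finset.card_image_of_injOn hinj]
  apply hF
  · intro E hE
    obtain ⟨G, hG, rfl⟩ := Finset.mem_image.1 hE
    exact h G hG _ (hf G hG)
  · intro E hE E' hE' hne
    obtain ⟨D, hD, rfl⟩ := Finset.mem_image.1 (Finset.mem_coe.1 hE)
    obtain ⟨D', hD', rfl⟩ := Finset.mem_image.1 (Finset.mem_coe.1 hE')
    exact hdisj D hD D' hD' (fun h => hne (by rw [h]))

lemma shadow_bound (a s : ℕ) : ∀ (n k : ℕ) (F : Finset (Finset ℕ)), 1 ≤ k →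
    F ⊆ (Finset.Ico a n).powersetCard k → NoMatch F s → Shifted F a →
    F.card ≤ s * F.shadow.card := by
  classical
  intro n
  induction n with
  | zero =>
    intro k F hk hF hM hS
    have : F = ∅ := by
      have : (Finset.Ico a 0).powersetCard k = ∅ := by
        apply Finset.powersetCard_eq_empty.2; simp; omega
      rw [this] at hF
      exact Finset.subset_empty.1 hF
    simp [this]
  | succ n ih =>
    intro k F hk hF hM hS
    by_cases hn : n + 1 < a + k * (s + 1)
    · have h := shadow_local F _ k hk hF
      have h2 : (Finset.Ico a (n+1)).card - (k - 1) ≤ k * s := by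
        rw [Nat.card_Ico]
        rw [mul_add] at hn
        omega
      have h3 := h.trans (Nat.mul_le_mul_left _ h2)
      have h4 : F.card * k ≤ (s * F.shadow.card) * k := by
        calc _ ≤ _ := h3
          _ = _ := by ring
      exact Nat.le_of_mul_le_mul_right h4 hk
    push Not at hn
    rcases Nat.eq_or_lt_of_le hk with rfl | hk2
    · have h1 : F.card ≤ s := by
        apply hM F le_rfl
        intro A hA B hB hne
        have h1 := (Finset.mem_powersetCard.1 (hF hA)).2
        have h2 := (Finset.mem_powersetCard.1 (hF hB)).2
        obtain ⟨x, rfl⟩ := Finset.card_eq_one.1 h1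
        obtain ⟨y, rfl⟩ := Finset.card_eq_one.1 h2
        simp only [Function.onFun, id, Finset.disjoint_singleton]
        rintro rfl
        exact hne rfl
      rcases F.eq_empty_or_nonempty with rfl | ⟨A, hA⟩
      · simp
      · have h2 := (Finset.mem_powersetCard.1 (hF hA)).2
        obtain ⟨x, rfl⟩ := Finset.card_eq_one.1 h2
        have : 0 < F.shadow.card := Finset.card_pos.2
          ⟨_, Finset.mem_shadow_iff.2 ⟨_, hA, x, by simp, rfl⟩⟩
        calc F.card ≤ s * 1 := by omega
          _ ≤ _ := Nat.mul_le_mul_left _ this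
    set F1 := F.filter (fun A => n ∉ A) with hF1
    set F2 := (F.filter (fun A => n ∈ A)).image (fun A => A.erase n) with hF2
    have memF2 : ∀ G, G ∈ F2 ↔ n ∉ G ∧ insert n G ∈ F := by
      intro G
      rw [hF2, Finset.mem_image]
      constructor
      · rintro ⟨A, hA, rfl⟩
        rw [Finset.mem_filter] at hA
        refine ⟨by simp, ?_⟩
        rw [Finset.insert_erase hA.2]; exact hA.1
      · rintro ⟨h1, h2⟩
        exact ⟨insert n G, by simp [h2], Finset.erase_insert h1⟩
    have hc : F.card = F1.card + F2.card := by
      rw [hF1, hF2, Finset.card_image_of_injOn, add_comm]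
      · exact (Finset.card_filter_add_card_filter_not (fun A => n ∈ A)).symm
      · intro A hA B hB h
        simp only [Finset.coe_filter, Set.mem_ofPred_eq] at hA hB
        simp only at h
        rw [← Finset.insert_erase hA.2, h, Finset.insert_erase hB.2]
    have sub2 : ∀ G ∈ F2, G ⊆ Finset.Ico a n ∧ G.card = k - 1 := by
      intro G hG
      obtain ⟨h1, h2⟩ := (memF2 G).1 hG
      obtain ⟨h3, h4⟩ := Finset.mem_powersetCard.1 (hF h2)
      rw [Finset.card_insert_of_notMem h1] at h4
      refine ⟨?_, by omega⟩
      intro x hx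
      have := h3 (Finset.mem_insert_of_mem hx)
      have hne : x ≠ n := by rintro rfl; exact h1 hx
      simp only [Finset.mem_Ico] at *
      omega
    have b1 : F1.card ≤ s * F1.shadow.card := by
      apply ih k F1 hk
      · intro A hA
        obtain ⟨h1, h2⟩ := Finset.mem_filter.1 hA
        obtain ⟨h3, h4⟩ := Finset.mem_powersetCard.1 (hF h1)
        refine Finset.mem_powersetCard.2 ⟨?_, h4⟩
        intro x hx
        have := h3 hx
        have hne : x ≠ n := by rintro rfl; exact h2 hx
        simp only [Finset.mem_Ico] at *
        omega
      · intro M hMs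
        exact hM M (hMs.trans (Finset.filter_subset _ _))
      · intro A hA j hj i hai hij hi
        obtain ⟨h1, h2⟩ := Finset.mem_filter.1 hA
        obtain ⟨h3, h4⟩ := Finset.mem_powersetCard.1 (hF h1)
        have := h3 hj
        refine Finset.mem_filter.2 ⟨hS A h1 j hj i hai hij hi, ?_⟩
        simp only [Finset.mem_Ico] at this
        rw [Finset.mem_insert, Finset.mem_erase]
        rintro (h | h)
        · omega
        · exact h2 h.2
    have b2 : F2.card ≤ s * F2.shadow.card := by
      apply ih (k-1) F2 (by omega)
      · intro G hG
        exact Finset.mem_powersetCard.2 (sub2 G hG)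
      · intro M hMs hMd
        by_contra hlt
        push Not at hlt
        obtain ⟨M', hM', hM'c⟩ := Finset.exists_subset_card_eq (Nat.succ_le_of_lt hlt)
        have hMd' : (M' : Set (Finset ℕ)).PairwiseDisjoint id :=
          hMd.subset (by exact_mod_cast hM')
        set U := M'.biUnion id with hU
        have hUc : U.card ≤ (s + 1) * (k - 1) := by
          rw [← Nat.succ_eq_add_one, ← hM'c]
          apply Finset.card_biUnion_le_card_mul
          intro G hG
          exact (sub2 G (hMs (hM' hG))).2.le
        have hUs : U ⊆ Finset.Ico a (n+1) := by
          intro x hx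
          obtain ⟨G, hG, hxG⟩ := Finset.mem_biUnion.1 hx
          have := (sub2 G (hMs (hM' hG))).1 hxG
          simp only [Finset.mem_Ico] at *
          omega
        have := extend_matching F M' (Finset.Ico a (n+1) \ U) s hM hMd' (by
          rw [hM'c, Finset.card_sdiff_of_subset hUs, Nat.card_Ico]
          obtain ⟨q, rfl⟩ : ∃ q, k = q + 1 := ⟨k - 1, by omega⟩
          simp only [Nat.add_sub_cancel] at hUc
          have : (q + 1) * (s + 1) = (s + 1) * q + (s + 1) := by ring
          omega) (by
          intro G hG
          apply Finset.disjoint_left.2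
          intro x hx hx2
          exact (Finset.mem_sdiff.1 hx2).2 (Finset.mem_biUnion.2 ⟨G, hG, hx⟩)) (by
          intro G hG x hx
          obtain ⟨h1, h2⟩ := (memF2 G).1 (hMs (hM' hG))
          obtain ⟨h3, h4⟩ := Finset.mem_sdiff.1 hx
          have hxG : x ∉ G := fun h => h4 (Finset.mem_biUnion.2 ⟨G, hG, h⟩)
          by_cases hxn : x = n
          · rw [hxn]; exact h2
          · rw [Finset.mem_Ico] at h3
            have := hS _ h2 n (by simp) x h3.1 (by omega) (by simp [hxn, hxG])
            rwa [Finset.erase_insert h1] at this)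
        omega
      · intro G hG j hj i hai hij hi
        obtain ⟨h1, h2⟩ := (memF2 G).1 hG
        have h3 := (sub2 G hG).1 hj
        rw [Finset.mem_Ico] at h3
        have h4 := hS _ h2 j (by simp [hj]) i hai hij (by
          rw [Finset.mem_insert]; rintro (h | h)
          · omega
          · exact hi h)
        refine (memF2 _).2 ⟨?_, ?_⟩
        · rw [Finset.mem_insert, Finset.mem_erase]; rintro (h | h)
          · omega
          · exact h1 h.2
        · convert h4 using 1
          ext x
          simp only [Finset.mem_insert, Finset.mem_erase]
          grind
    have hsh : F1.shadow.card + F2.shadow.card ≤ F.shadow.card := by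
      have hn2 : ∀ G ∈ F2.shadow, n ∉ G := by
        intro G hG
        obtain ⟨A, hA, x, hx, rfl⟩ := Finset.mem_shadow_iff.1 hG
        exact fun h => ((memF2 A).1 hA).1 (Finset.mem_of_mem_erase h)
      have hinj : Set.InjOn (fun G => insert n G) (F2.shadow : Set (Finset ℕ)) := by
        intro G hG G' hG' h
        simp only at h
        rw [← Finset.erase_insert (hn2 G hG), h, Finset.erase_insert (hn2 G' hG')]
      rw [← Finset.card_image_of_injOn hinj, ← Finset.card_union_of_disjoint]
      · apply Finset.card_le_card
        intro G hG
        rcases Finset.mem_union.1 hG with hG | hG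
        · exact Finset.shadow_monotone (Finset.filter_subset _ _) hG
        · obtain ⟨G, hG', rfl⟩ := Finset.mem_image.1 hG
          obtain ⟨A, hA, x, hx, rfl⟩ := Finset.mem_shadow_iff.1 hG'
          obtain ⟨h1, h2⟩ := (memF2 A).1 hA
          refine Finset.mem_shadow_iff.2 ⟨_, h2, x, by simp [hx], ?_⟩
          rw [Finset.erase_insert_of_ne]
          rintro rfl; exact h1 hx
      · apply Finset.disjoint_left.2
        intro G hG hG2
        obtain ⟨A, hA, x, hx, rfl⟩ := Finset.mem_shadow_iff.1 hG
        obtain ⟨G', hG', h⟩ := Finset.mem_image.1 hG2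
        apply (Finset.mem_filter.1 hA).2
        apply Finset.mem_of_mem_erase (a := x)
        rw [← h]; simp
    calc F.card = F1.card + F2.card := hc
      _ ≤ s * F1.shadow.card + s * F2.shadow.card := add_le_add b1 b2
      _ = s * (F1.shadow.card + F2.shadow.card) := by ring
      _ ≤ _ := Nat.mul_le_mul_left _ hsh

/-- A uniformly random ordered matching of `t` disjoint `l`-subsets of `T`. -/
lemma averaging (T : Finset ℕ) (t l : ℕ) (h : t * l ≤ T.card) :
    ∃ (Ω : Type) (_ : Fintype Ω) (B : Ω → Fin t → Finset ℕ), 0 < Fintype.card Ω ∧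
      (∀ ω j, B ω j ∈ T.powersetCard l) ∧
      (∀ ω i j, i ≠ j → Disjoint (B ω i) (B ω j)) ∧
      ∀ j, ∀ A ∈ T.powersetCard l,
        (Finset.univ.filter (fun ω => B ω j = A)).card * T.card.choose l = Fintype.card Ω := by
  classical
  obtain ⟨p⟩ : Nonempty (Fin t × Fin l ↪ T) :=
    Function.Embedding.nonempty_of_card_le (by simpa using h)
  set C : Fin t → Finset T := fun j => Finset.univ.image (fun x => p (j, x)) with hC
  have hCc : ∀ j, (C j).card = l := by
    intro j
    rw [hC, Finset.card_image_of_injective]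
    · simp
    · intro x y hxy
      simpa using p.injective hxy
  have hCd : ∀ i j, i ≠ j → Disjoint (C i) (C j) := by
    intro i j hij
    apply Finset.disjoint_left.2
    intro x hx hx2
    obtain ⟨y, -, rfl⟩ := Finset.mem_image.1 hx
    obtain ⟨z, -, hz⟩ := Finset.mem_image.1 hx2
    have := p.injective hz
    simp only [Prod.mk.injEq] at this
    exact hij this.1.symm
  set B : Equiv.Perm T → Fin t → Finset ℕ := fun ω j =>
    ((C j).map ω.toEmbedding).map (Function.Embedding.subtype _) with hB
  have hBm : ∀ ω j, B ω j ∈ T.powersetCard l := by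
    intro ω j
    rw [Finset.mem_powersetCard]
    refine ⟨?_, by simp [hB, hCc]⟩
    intro x hx
    obtain ⟨y, hy, rfl⟩ := Finset.mem_map.1 hx
    exact y.2
  refine ⟨Equiv.Perm T, inferInstance, B, Fintype.card_pos, hBm, ?_, ?_⟩
  · intro ω i j hij
    simp only [hB, Finset.disjoint_map]
    exact hCd i j hij
  · intro j A hA
    have key : ∀ A' ∈ T.powersetCard l,
        (Finset.univ.filter (fun ω => B ω j = A')).card
          = (Finset.univ.filter (fun ω => B ω j = A)).card := by
      intro A' hA'
      have lift : ∀ D ∈ T.powersetCard l, ∃ D' : Finset T,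
          D'.map (Function.Embedding.subtype _) = D ∧ D'.card = l := by
        intro D hD
        rw [Finset.mem_powersetCard] at hD
        have h1 : (D.subtype (· ∈ T)).map (Function.Embedding.subtype _) = D :=
          Finset.subtype_map_of_mem hD.1
        refine ⟨D.subtype (· ∈ T), h1, ?_⟩
        rw [← hD.2]
        conv_rhs => rw [← h1]
        rw [Finset.card_map]
      obtain ⟨D, hD, hDc⟩ := lift A hA
      obtain ⟨D', hD', hDc'⟩ := lift A' hA'
      obtain ⟨τ, hτ⟩ := Equiv.Perm.exists_map_finset_eq D' D (hDc'.trans hDc.symm)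
      apply Finset.card_bij (fun ω _ => ω.trans τ)
      · intro ω hω
        simp only [Finset.mem_filter, Finset.mem_univ, true_and] at hω ⊢
        simp only [hB, ← hD', ← hD] at hω ⊢
        have h2 := Finset.map_injective _ hω
        have h3 : (C j).map (ω.trans τ).toEmbedding
            = ((C j).map ω.toEmbedding).map τ.toEmbedding := by
          rw [Finset.map_map]; rfl
        rw [h3, h2, hτ]
      · intro ω _ ω' _ h
        ext x
        have := congrArg (fun e => e x) h
        simp only [Equiv.trans_apply, EmbeddingLike.apply_eq_iff_eq] at this
        rw [this]
      · intro ω hω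
        refine ⟨ω.trans τ.symm, ?_, by ext; simp⟩
        simp only [Finset.mem_filter, Finset.mem_univ, true_and] at hω ⊢
        simp only [hB, ← hD', ← hD] at hω ⊢
        have h2 := Finset.map_injective _ hω
        congr 1
        apply Finset.map_injective τ.toEmbedding
        rw [hτ, ← h2, Finset.map_map]
        congr 1
        ext x
        simp
    have h1 := Finset.card_eq_sum_card_fiberwise (s := (Finset.univ : Finset (Equiv.Perm T)))
      (f := fun ω => B ω j) (t := T.powersetCard l) (fun ω _ => hBm ω j)
    rw [Finset.sum_congr rfl key, Finset.sum_const, Finset.card_powersetCard, smul_eq_mul,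
      Finset.card_univ] at h1
    rw [h1, mul_comm]

lemma pointwise (s t : ℕ) (N : ℕ → Finset (Fin t))
    (hN : ∀ i j, i ≤ j → j ≤ s → N j ⊆ N i)
    (h : ¬ ∃ f : Fin (s + 1) → Fin t, Function.Injective f ∧ ∀ i : Fin (s + 1), f i ∈ N (i : ℕ)) :
    ∃ u ≤ s, ∑ i ∈ Finset.range s, (N i).card + (s + 1) * (N s).card + u * t
      ≤ s * t + u * (u + s + 1) := by
  classical
  rw [← Finset.all_card_le_biUnion_card_iff_exists_injective
    (fun i : Fin (s + 1) => N i)] at h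
  push Not at h
  obtain ⟨S, hS⟩ := h
  have hne : S.Nonempty := by
    rw [Finset.nonempty_iff_ne_empty]; rintro rfl; simp at hS
  set i := S.min' hne with hi
  have hiS : i ∈ S := S.min'_mem hne
  have h1 : S.card ≤ s + 1 - i := by
    have : S ⊆ Finset.Ici i := fun x hx => Finset.mem_Ici.2 (S.min'_le x hx)
    simpa using Finset.card_le_card this
  have h2 : (N i).card ≤ (S.biUnion fun i : Fin (s + 1) => N i).card :=
    Finset.card_le_card (Finset.subset_biUnion_of_mem (fun i : Fin (s + 1) => N i) hiS)
  have his := i.2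
  generalize hp : (i : ℕ) = p at *
  obtain ⟨u, rfl⟩ : ∃ u, s = p + u := ⟨s - p, by omega⟩
  have h3 : (N p).card ≤ u := by omega
  refine ⟨u, by omega, ?_⟩
  rw [Finset.sum_range_add]
  have a1 : ∑ x ∈ Finset.range p, (N x).card ≤ p * t := by
    have := Finset.sum_le_card_nsmul (Finset.range p) (fun x => (N x).card) t
      (fun x _ => by simpa using Finset.card_le_univ (N x))
    simpa using this
  have a2 : ∑ x ∈ Finset.range u, (N (p + x)).card ≤ u * u := by
    have := Finset.sum_le_card_nsmul (Finset.range u) (fun x => (N (p + x)).card) u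
      (fun x hx => (Finset.card_le_card (hN p (p + x) (by omega)
        (by have := Finset.mem_range.1 hx; omega))).trans h3)
    simpa using this
  have a3 : (N (p + u)).card ≤ u :=
    (Finset.card_le_card (hN p (p + u) (by omega) le_rfl)).trans h3
  nlinarith [Nat.mul_le_mul_left (p + u + 1) a3]

lemma count_one (F : Finset (Finset ℕ)) (n l s : ℕ)
    (hF : F ⊆ (Finset.range n).powersetCard (l + 1)) :
    (F.filter (fun A => (A ∩ Finset.range (s + 1)).card = 1)).card =
      ∑ i ∈ Finset.range (s + 1),
        (((Finset.Ico (s + 1) n).powersetCard l).filter (fun G => insert i G ∈ F)).card := by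
  classical
  have hni : ∀ i ∈ Finset.range (s + 1), ∀ G ∈ (Finset.Ico (s + 1) n).powersetCard l, i ∉ G := by
    intro i hi G hG h
    have := (Finset.mem_powersetCard.1 hG).1 h
    simp only [Finset.mem_range, Finset.mem_Ico] at *
    omega
  have hinter : ∀ i ∈ Finset.range (s + 1), ∀ G ∈ (Finset.Ico (s + 1) n).powersetCard l,
      insert i G ∩ Finset.range (s + 1) = {i} := by
    intro i hi G hG
    ext x
    have h1 : x ∈ G → x ∈ Finset.Ico (s + 1) n := fun h => (Finset.mem_powersetCard.1 hG).1 h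
    simp only [Finset.mem_range, Finset.mem_Ico, Finset.mem_inter, Finset.mem_insert,
      Finset.mem_singleton] at *
    constructor
    · rintro ⟨h | h, h2⟩
      · exact h
      · have := h1 h; omega
    · rintro rfl; exact ⟨Or.inl rfl, hi⟩
  have hEq : F.filter (fun A => (A ∩ Finset.range (s + 1)).card = 1) =
      (Finset.range (s + 1)).biUnion (fun i =>
        (((Finset.Ico (s + 1) n).powersetCard l).filter (fun G => insert i G ∈ F)).image
          (fun G => insert i G)) := by
    ext A
    simp only [Finset.mem_filter, Finset.mem_biUnion, Finset.mem_image]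
    constructor
    · rintro ⟨hA, hc⟩
      obtain ⟨i, hi⟩ := Finset.card_eq_one.1 hc
      have hiA : i ∈ A ∩ Finset.range (s + 1) := by rw [hi]; simp
      rw [Finset.mem_inter] at hiA
      obtain ⟨h1, h2⟩ := Finset.mem_powersetCard.1 (hF hA)
      refine ⟨i, hiA.2, A.erase i, ⟨?_, ?_⟩, Finset.insert_erase hiA.1⟩
      · rw [Finset.mem_powersetCard]
        refine ⟨?_, by rw [Finset.card_erase_of_mem hiA.1, h2]; rfl⟩
        intro x hx
        rw [Finset.mem_erase] at hx
        have h3 := h1 hx.2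
        have h4 : x ∉ A ∩ Finset.range (s + 1) := by rw [hi]; simp [hx.1]
        simp only [Finset.mem_inter, Finset.mem_range, Finset.mem_Ico, not_and] at *
        have := h4 hx.2
        omega
      · rw [Finset.insert_erase hiA.1]; exact hA
    · rintro ⟨i, hi, G, ⟨hG, hGF⟩, rfl⟩
      exact ⟨hGF, by rw [hinter i hi G hG]; simp⟩
  rw [hEq, Finset.card_biUnion]
  · apply Finset.sum_congr rfl
    intro i hi
    apply Finset.card_image_of_injOn
    intro G hG G' hG' h
    simp only [Finset.coe_filter, Set.mem_ofPred_eq] at hG hG'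
    simp only at h
    rw [← Finset.erase_insert (hni i hi G hG.1), h, Finset.erase_insert (hni i hi G' hG'.1)]
  · intro i hi i' hi' hne
    apply Finset.disjoint_left.2
    intro A hA hA'
    obtain ⟨G, hG, rfl⟩ := Finset.mem_image.1 hA
    obtain ⟨G', hG', h⟩ := Finset.mem_image.1 hA'
    have h1 := hinter i hi G (Finset.mem_filter.1 hG).1
    have h2 := hinter i' hi' G' (Finset.mem_filter.1 hG').1
    rw [h, h1] at h2
    exact hne (by simpa using h2)

lemma filter_zero (F : Finset (Finset ℕ)) (n k s : ℕ)
    (hF : F ⊆ (Finset.range n).powersetCard k) :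
    F.filter (fun A => (A ∩ Finset.range (s + 1)).card = 0) =
      F ∩ (Finset.Ico (s + 1) n).powersetCard k := by
  ext A
  rw [Finset.mem_filter, Finset.mem_inter]
  refine and_congr_right fun hA => ?_
  obtain ⟨h1, h2⟩ := Finset.mem_powersetCard.1 (hF hA)
  rw [Finset.mem_powersetCard, Finset.card_eq_zero]
  constructor
  · intro h
    refine ⟨fun x hx => ?_, h2⟩
    have h3 := h1 hx
    have h4 : x ∉ A ∩ Finset.range (s + 1) := by rw [h]; simp
    simp only [Finset.mem_inter, Finset.mem_range, Finset.mem_Ico, not_and] at *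
    have := h4 hx
    omega
  · rintro ⟨h, -⟩
    ext x
    simp only [Finset.mem_inter, Finset.notMem_empty, iff_false, not_and]
    intro hx
    have := h hx
    simp only [Finset.mem_range, Finset.mem_Ico] at *
    omega

lemma card_split (F : Finset (Finset ℕ)) (s : ℕ) :
    F.card = (F.filter (fun A => (A ∩ Finset.range (s + 1)).card = 0)).card
      + (F.filter (fun A => (A ∩ Finset.range (s + 1)).card = 1)).card
      + (F.filter (fun A => 2 ≤ (A ∩ Finset.range (s + 1)).card)).card := by
  simp only [Finset.card_filter, ← Finset.sum_add_distrib]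
  rw [Finset.card_eq_sum_ones]
  apply Finset.sum_congr rfl
  intro A _
  split_ifs <;> omega

lemma card_reduce (F : Finset (Finset ℕ)) (n l s : ℕ) (hn : s + 1 ≤ n)
    (hF : F ⊆ (Finset.range n).powersetCard (l + 1)) :
    F.card + (n - s).choose (l + 1) + s * (n - s - 1).choose l ≤
      n.choose (l + 1) + (F ∩ (Finset.Ico (s + 1) n).powersetCard (l + 1)).card +
      ∑ i ∈ Finset.range (s + 1),
        (((Finset.Ico (s + 1) n).powersetCard l).filter (fun G => insert i G ∈ F)).card := by
  classical
  set P := (Finset.range n).powersetCard (l + 1) with hP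
  have e1 := card_split F s
  have e2 := card_split P s
  rw [filter_zero F n (l+1) s hF, count_one F n l s hF] at e1
  rw [filter_zero P n (l+1) s le_rfl, count_one P n l s le_rfl] at e2
  have e3 : (F.filter (fun A => 2 ≤ (A ∩ Finset.range (s + 1)).card)).card ≤
     (P.filter (fun A => 2 ≤ (A ∩ Finset.range (s + 1)).card)).card :=
    Finset.card_le_card (Finset.filter_subset_filter _ hF)
  have e4 : P.card = n.choose (l + 1) := by simp [hP]
  have e5 : (P ∩ (Finset.Ico (s + 1) n).powersetCard (l + 1)).card
      = (n - s - 1).choose (l + 1) := by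
    rw [Finset.inter_eq_right.2]
    · rw [Finset.card_powersetCard, Nat.card_Ico, Nat.sub_sub]
    · apply Finset.powersetCard_mono
      intro x hx
      simp only [Finset.mem_range, Finset.mem_Ico] at *
      omega
  have e6 : ∑ i ∈ Finset.range (s + 1),
        (((Finset.Ico (s + 1) n).powersetCard l).filter (fun G => insert i G ∈ P)).card
        = (s + 1) * (n - s - 1).choose l := by
    rw [Finset.sum_congr rfl (g := fun _ => (n - s - 1).choose l)]
    · simp
    · intro i hi
      rw [Finset.filter_true_of_mem]
      · rw [Finset.card_powersetCard, Nat.card_Ico, Nat.sub_sub]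
      · intro G hG
        obtain ⟨h1, h2⟩ := Finset.mem_powersetCard.1 hG
        rw [hP, Finset.mem_powersetCard]
        constructor
        · intro x hx
          rcases Finset.mem_insert.1 hx with rfl | hx
          · simp only [Finset.mem_range] at *; omega
          · have := h1 hx
            simp only [Finset.mem_range, Finset.mem_Ico] at *
            omega
        · rw [Finset.card_insert_of_notMem, h2]
          intro h
          have := h1 h
          simp only [Finset.mem_range, Finset.mem_Ico] at *
          omega
  have e7 : (n - s).choose (l + 1) = (n - s - 1).choose l + (n - s - 1).choose (l + 1) := by
    obtain ⟨q, hq⟩ : ∃ q, n - s = q + 1 := ⟨n - s - 1, by omega⟩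
    rw [hq]; exact Nat.choose_succ_succ q l
  rw [e4, e5, e6] at e2
  rw [e7]
  have : (s + 1) * (n - s - 1).choose l = s * (n - s - 1).choose l + (n - s - 1).choose l := by
    ring
  omega

lemma arith_bound (γ s t l u S : ℝ) (hγ0 : 0 ≤ γ) (hγ : γ ≤ 2 * l) (ht : γ * (s + 1) ≤ t * l)
    (hu0 : 0 ≤ u) (hus : u ≤ s) (ht0 : 0 ≤ t)
    (hS : S + u * t ≤ s * t + u * (u + s + 1)) : γ * S ≤ 2 * l * s * t := by
  have hs : 0 ≤ s := hu0.trans hus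
  rcases le_total (u + s + 1) t with h | h
  · have h1 : S ≤ s * t := by nlinarith
    calc γ * S ≤ γ * (s * t) := mul_le_mul_of_nonneg_left h1 hγ0
      _ ≤ 2 * l * (s * t) := mul_le_mul_of_nonneg_right hγ (mul_nonneg hs ht0)
      _ = _ := by ring
  · have h1 : u * (u + s + 1 - t) ≤ s * (s + s + 1 - t) :=
      mul_le_mul hus (by linarith) (by linarith) hs
    have h2 : S ≤ s * (2 * (s + 1)) := by nlinarith
    calc γ * S ≤ γ * (s * (2 * (s + 1))) := mul_le_mul_of_nonneg_left h2 hγ0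
      _ = 2 * s * (γ * (s + 1)) := by ring
      _ ≤ 2 * s * (t * l) := mul_le_mul_of_nonneg_left ht (by linarith)
      _ = _ := by ring

lemma key_bound (F : Finset (Finset ℕ)) (n l s t : ℕ) (γ : ℝ)
    (hM : NoMatch F s) (hS : Shifted F 0)
    (ht : t * l ≤ (Finset.Ico (s + 1) n).card) (ht0 : 0 < t)
    (hγ0 : 0 ≤ γ) (hγ : γ ≤ 2 * l) (hγt : γ * (s + 1) ≤ t * l) :
    γ * (((F ∩ (Finset.Ico (s + 1) n).powersetCard (l + 1)).card +
      ∑ i ∈ Finset.range (s + 1),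
        (((Finset.Ico (s + 1) n).powersetCard l).filter (fun G => insert i G ∈ F)).card : ℕ) : ℝ)
      ≤ 2 * l * s * ((Finset.Ico (s + 1) n).card.choose l : ℝ) := by
  classical
  set T := Finset.Ico (s + 1) n with hT
  set Fi : ℕ → Finset (Finset ℕ) := fun i =>
    (T.powersetCard l).filter (fun G => insert i G ∈ F) with hFi
  have hTlt : ∀ G ∈ T.powersetCard l, ∀ i ≤ s, i ∉ G := by
    intro G hG i hi h
    have := (Finset.mem_powersetCard.1 hG).1 h
    rw [hT, Finset.mem_Ico] at this
    omega
  -- the part of `F` avoiding the head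
  have hzero : (F ∩ T.powersetCard (l + 1)).card ≤ s * (Fi s).card := by
    refine (shadow_bound (s + 1) s n (l + 1) _ (by omega) Finset.inter_subset_right ?_ ?_).trans ?_
    · intro M hMs
      exact hM M (hMs.trans Finset.inter_subset_left)
    · intro A hA j hj i hai hij hi
      obtain ⟨h1, h2⟩ := Finset.mem_inter.1 hA
      obtain ⟨h3, h4⟩ := Finset.mem_powersetCard.1 h2
      refine Finset.mem_inter.2 ⟨hS A h1 j hj i (Nat.zero_le _) hij hi, ?_⟩
      rw [Finset.mem_powersetCard]
      constructor
      · intro x hx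
        have hjT := h3 hj
        rcases Finset.mem_insert.1 hx with rfl | hx
        · rw [Finset.mem_Ico] at *; omega
        · exact h3 (Finset.mem_of_mem_erase hx)
      · rw [Finset.card_insert_of_notMem (fun h => hi (Finset.mem_of_mem_erase h)),
          Finset.card_erase_of_mem hj, h4]; rfl
    · apply Nat.mul_le_mul_left
      apply Finset.card_le_card
      intro G hG
      obtain ⟨A, hA, x, hx, rfl⟩ := Finset.mem_shadow_iff.1 hG
      obtain ⟨h1, h2⟩ := Finset.mem_inter.1 hA
      obtain ⟨h3, h4⟩ := Finset.mem_powersetCard.1 h2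
      rw [hFi, Finset.mem_filter, Finset.mem_powersetCard]
      refine ⟨⟨(Finset.erase_subset _ _).trans h3, by rw [Finset.card_erase_of_mem hx, h4]; rfl⟩, ?_⟩
      have hxT := h3 hx
      rw [Finset.mem_Ico] at hxT
      apply hS A h1 x hx s (Nat.zero_le _) (by omega)
      intro h
      have := h3 h
      rw [Finset.mem_Ico] at this
      omega
  obtain ⟨Ω, _, B, hΩ, hB1, hB2, hB3⟩ := averaging T t l ht
  set N : Ω → ℕ → Finset (Fin t) := fun ω i =>
    Finset.univ.filter (fun j => insert i (B ω j) ∈ F) with hN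
  have hpt : ∀ ω, γ * ((∑ i ∈ Finset.range s, (N ω i).card + (s + 1) * (N ω s).card : ℕ) : ℝ)
      ≤ 2 * l * s * t := by
    intro ω
    obtain ⟨u, hu, hle⟩ := pointwise s t (N ω) (by
      intro i j hij hjs x hx
      simp only [hN, Finset.mem_filter, Finset.mem_univ, true_and] at hx ⊢
      rcases Nat.eq_or_lt_of_le hij with rfl | hij
      · exact hx
      have hj := hTlt _ (hB1 ω x) j hjs
      have hi := hTlt _ (hB1 ω x) i (by omega)
      have := hS _ hx j (by simp) i (Nat.zero_le _) hij (by simp [hi]; omega)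
      rwa [Finset.erase_insert hj] at this) (by
      rintro ⟨f, hf, hfN⟩
      simp only [hN, Finset.mem_filter, Finset.mem_univ, true_and] at hfN
      have hd : ∀ i i' : Fin (s + 1), i ≠ i' →
          Disjoint (insert (i : ℕ) (B ω (f i))) (insert (i' : ℕ) (B ω (f i'))) := by
        intro i i' hne
        have h1 := hTlt _ (hB1 ω (f i)) i' (by omega)
        have h2 := hTlt _ (hB1 ω (f i')) i (by omega)
        have h3 := hB2 ω (f i) (f i') (fun h => hne (hf h))
        rw [Finset.disjoint_insert_left, Finset.disjoint_insert_right, Finset.mem_insert]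
        refine ⟨?_, h1, h3⟩
        rintro (h | h)
        · exact hne (Fin.ext h)
        · exact h2 h
      have hinj : Function.Injective (fun i : Fin (s + 1) => insert (i : ℕ) (B ω (f i))) := by
        intro i i' h
        by_contra hne
        have := hd i i' hne
        simp only at h
        rw [h, disjoint_self] at this
        exact Finset.insert_ne_empty _ _ this
      have := hM (Finset.univ.image (fun i : Fin (s + 1) => insert (i : ℕ) (B ω (f i)))) (by
        intro A hA
        obtain ⟨i, -, rfl⟩ := Finset.mem_image.1 hA
        exact hfN i) (by
        intro A hA A' hA' hne
        obtain ⟨i, -, rfl⟩ := Finset.mem_image.1 (Finset.mem_coe.1 hA)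
        obtain ⟨i', -, rfl⟩ := Finset.mem_image.1 (Finset.mem_coe.1 hA')
        exact hd i i' (fun h => hne (by rw [h])))
      rw [Finset.card_image_of_injective _ hinj] at this
      simp at this)
    apply arith_bound γ s t l u _ hγ0 hγ hγt (by positivity) (by exact_mod_cast hu)
      (by positivity)
    exact_mod_cast hle
  have havg : ∀ i, (∑ ω, (N ω i).card) * T.card.choose l
      = t * (Fi i).card * Fintype.card Ω := by
    intro i
    have h1 : ∑ ω, (N ω i).card
        = ∑ j : Fin t, ∑ A ∈ Fi i, (Finset.univ.filter (fun ω => B ω j = A)).card := by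
      simp only [hN, Finset.card_filter]
      rw [Finset.sum_comm]
      apply Finset.sum_congr rfl
      intro j _
      rw [Finset.sum_comm]
      apply Finset.sum_congr rfl
      intro ω _
      rw [Finset.sum_ite_eq]
      simp only [hFi, Finset.mem_filter, hB1 ω j, true_and]
    rw [h1, Finset.sum_mul]
    simp only [Finset.sum_mul]
    rw [Finset.sum_congr rfl (g := fun _ => (Fi i).card * Fintype.card Ω)]
    · simp [mul_assoc]
    · intro j _
      rw [Finset.sum_congr rfl (g := fun _ => Fintype.card Ω)]
      · simp
      · intro A hA
        exact hB3 j A (Finset.mem_filter.1 hA).1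
  set W := ∑ i ∈ Finset.range s, (Fi i).card + (s + 1) * (Fi s).card with hW
  have hsum : (∑ ω, (∑ i ∈ Finset.range s, (N ω i).card + (s + 1) * (N ω s).card))
      * T.card.choose l = t * W * Fintype.card Ω := by
    rw [Finset.sum_add_distrib, Finset.sum_comm, ← Finset.mul_sum, add_mul, Finset.sum_mul,
      mul_assoc, havg, Finset.sum_congr rfl (fun i _ => havg i), ← Finset.sum_mul,
      ← Finset.mul_sum, hW]
    ring
  have hle : (F ∩ T.powersetCard (l + 1)).card + ∑ i ∈ Finset.range (s + 1), (Fi i).card ≤ W := by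
    rw [Finset.sum_range_succ, hW, add_mul]
    omega
  have htot : γ * ((∑ ω, (∑ i ∈ Finset.range s, (N ω i).card + (s + 1) * (N ω s).card) : ℕ) : ℝ)
      ≤ Fintype.card Ω * (2 * l * s * t) := by
    rw [Nat.cast_sum, Finset.mul_sum]
    have := Finset.sum_le_sum (fun ω (_ : ω ∈ (Finset.univ : Finset Ω)) => hpt ω)
    simpa using this
  have hsumR : ((∑ ω, (∑ i ∈ Finset.range s, (N ω i).card + (s + 1) * (N ω s).card) : ℕ) : ℝ)
      * (T.card.choose l : ℝ) = t * W * Fintype.card Ω := by exact_mod_cast hsum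
  have h5 := mul_le_mul_of_nonneg_right htot (Nat.cast_nonneg (α := ℝ) (T.card.choose l))
  rw [mul_assoc, hsumR] at h5
  have hpos : (0 : ℝ) < t * Fintype.card Ω := by positivity
  refine (mul_le_mul_of_nonneg_left (Nat.cast_le.2 hle) hγ0).trans ?_
  refine le_of_mul_le_mul_right ?_ hpos
  calc γ * W * (t * Fintype.card Ω) = γ * (t * W * Fintype.card Ω) := by ring
    _ ≤ _ := h5
    _ = _ := by ring

/-- Theorem 1.5 (main theorem on the Erdős Matching Conjecture):
if `F ⊆ C([n],k)` has maximum matching size exactly `s`, `1 < α ≤ 2 - 1/k` and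
`n ≥ αk(s+1) + k - 1`, then
`|F| ≤ C(n,k) - C(n-s,k) + ((2-α)k-1)/(αk-1) · s · C(n-s-1,k-1)`. -/
theorem stmt_0 (n k s : ℕ) (α : ℝ) (hα1 : 1 < α) (hα2 : α ≤ 2 - 1 / k)
    (hn : α * k * (s + 1) + k - 1 ≤ (n : ℝ))
    (F : Finset (Finset ℕ)) (hF : F ⊆ (Finset.range n).powersetCard k)
    (hmatch : ∃ M ⊆ F, (M : Set (Finset ℕ)).PairwiseDisjoint id ∧ M.card = s)
    (hmax : ∀ M ⊆ F, (M : Set (Finset ℕ)).PairwiseDisjoint id → M.card ≤ s) :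
    (F.card : ℝ) ≤ (n.choose k : ℝ) - ((n - s).choose k : ℝ) +
      ((2 - α) * k - 1) / (α * k - 1) * s * ((n - s - 1).choose (k - 1) : ℝ) := by
  classical
  rcases Nat.eq_zero_or_pos k with rfl | hk
  · have h1 : F.card ≤ s := by
      apply hmax F le_rfl
      intro A hA B hB hne
      have h1 := hF hA
      have h2 := hF hB
      simp only [Finset.powersetCard_zero, Finset.mem_singleton] at h1 h2
      exact absurd (h1.trans h2.symm) hne
    have h2 : (F.card : ℝ) ≤ s := by exact_mod_cast h1
    simpa using h2
  rcases Nat.eq_or_lt_of_le hk with rfl | hk2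
  · norm_num at hα2; linarith
  obtain ⟨l, rfl⟩ : ∃ l, k = l + 1 := ⟨k - 1, by omega⟩
  have hl : 1 ≤ l := by omega
  have hlR : (1 : ℝ) ≤ l := by exact_mod_cast hl
  push_cast at hα2 hn ⊢
  set γ : ℝ := α * (l + 1) - 1 with hγ
  have hγl : (l : ℝ) < γ := by rw [hγ]; nlinarith
  have hγ2 : γ ≤ 2 * l := by
    have h1 : α * (l + 1) ≤ (2 - 1 / ((l : ℝ) + 1)) * (l + 1) :=
      mul_le_mul_of_nonneg_right hα2 (by linarith)
    have h2 : (2 - 1 / ((l : ℝ) + 1)) * (l + 1) = 2 * l + 1 := by field_simp; ring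
    linarith
  have hγpos : 0 < γ := by linarith
  have hs0 : (0 : ℝ) ≤ s := Nat.cast_nonneg s
  have hnR : γ * (s + 1) + (s + 1) + l ≤ (n : ℝ) := by rw [hγ]; linarith
  have hns : s + 1 ≤ n := by
    have : ((s + 1 : ℕ) : ℝ) ≤ n := by push_cast; nlinarith
    exact_mod_cast this
  obtain ⟨m, rfl⟩ : ∃ m, n = s + 1 + m := ⟨n - (s + 1), by omega⟩
  push_cast at hnR
  have hTc : (Finset.Ico (s + 1) (s + 1 + m)).card = m := by simp
  have hdiv : (m : ℝ) < (m / l : ℕ) * l + l := by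
    have := Nat.lt_div_mul_add (a := m) (b := l) (by omega)
    exact_mod_cast this
  have hγt : γ * (s + 1) ≤ (m / l : ℕ) * l := by linarith
  have ht0 : 0 < m / l := by
    rcases Nat.eq_zero_or_pos (m / l) with h | h
    · rw [h] at hγt
      have : 0 < γ * (s + 1) := by positivity
      simp at hγt; linarith
    · exact h
  obtain ⟨G, hG1, hG2, hG3, hG4⟩ := exists_shifted (l + 1) (s + 1 + m) s _ F rfl hF hmax
  have hkey := key_bound G (s + 1 + m) l s (m / l) γ hG2 hG4
    (by rw [hTc]; exact Nat.div_mul_le_self m l) ht0 hγpos.le hγ2 hγt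
  have hred := card_reduce G (s + 1 + m) l s hns hG1
  rw [hG3] at hred
  rw [hTc] at hkey
  rw [show s + 1 + m - s - 1 = m by omega] at hred ⊢
  have hredR : (F.card : ℝ) + ((s + 1 + m - s).choose (l + 1) : ℝ) + s * (m.choose l : ℝ) ≤
      ((s + 1 + m).choose (l + 1) : ℝ) +
      (((G ∩ (Finset.Ico (s + 1) (s + 1 + m)).powersetCard (l + 1)).card +
      ∑ i ∈ Finset.range (s + 1), (((Finset.Ico (s + 1) (s + 1 + m)).powersetCard l).filter
        (fun D => insert i D ∈ G)).card : ℕ) : ℝ) := by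
    rw [add_assoc ((s + 1 + m).choose (l + 1))] at hred
    exact_mod_cast hred
  have h6 : (((G ∩ (Finset.Ico (s + 1) (s + 1 + m)).powersetCard (l + 1)).card +
      ∑ i ∈ Finset.range (s + 1), (((Finset.Ico (s + 1) (s + 1 + m)).powersetCard l).filter
        (fun D => insert i D ∈ G)).card : ℕ) : ℝ) ≤ 2 * l * s * (m.choose l : ℝ) / γ := by
    rw [le_div_iff₀ hγpos, mul_comm]
    exact hkey
  have h7 : ((2 - α) * ((l : ℝ) + 1) - 1) / γ * s * (m.choose l : ℝ)
      = 2 * l * s * (m.choose l : ℝ) / γ - s * (m.choose l : ℝ) := by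
    have : (2 - α) * ((l : ℝ) + 1) - 1 = 2 * l - γ := by rw [hγ]; ring
    rw [this]
    field_simp
  rw [h7]
  linarith
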